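/- Let a ∈ (0,1) and n > 0. For w > 0 define Q_n(w; a) = ∫₁^∞ e^{-w³t}·(t/(t-1))^a·t^{-2n/3} dt (this integral converges absolutely for every w > 0). Then there exists a function F : ℂ → ℂ which is complex analytic on the open upper half-plane {w ∈ ℂ : Im(w) > 0}, continuous on {w ∈ ℂ : Im(w) ≥ 0, w ≠ 0}, and satisfies F(w) = Q_n(w; a) for every real w > 0. -/

import Mathlib

open MeasureTheory

open Set Filter Topology

/-- A parametric integral of holomorphic functions with a locally uniform integrable bound is
holomorphic. -/
theorem differentiableOn_integral_of_locally_dominated {α : Type*} [MeasurableSpace α]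
    {μ : Measure α} {F : ℂ → α → ℂ} {U : Set ℂ} (hU : IsOpen U)
    (hdiff : ∀ᵐ x ∂μ, DifferentiableOn ℂ (fun z => F z x) U)
    (hmeas : ∀ z ∈ U, AEStronglyMeasurable (F z) μ)
    (hbound : ∀ z₀ ∈ U, ∃ V ∈ 𝓝 z₀, ∃ b : α → ℝ, Integrable b μ ∧
      ∀ᵐ x ∂μ, ∀ z ∈ V, ‖F z x‖ ≤ b x) :
    DifferentiableOn ℂ (fun z => ∫ x, F z x ∂μ) U := by
  intro z₀ hz₀
  obtain ⟨V, hV, b, hb, hFb⟩ := hbound z₀ hz₀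
  obtain ⟨ε, hε, hball⟩ := Metric.mem_nhds_iff.1 (inter_mem hV (hU.mem_nhds hz₀))
  have hdiffAt : ∀ᵐ x ∂μ, ∀ z ∈ Metric.ball z₀ ε, DifferentiableAt ℂ (fun z => F z x) z := by
    filter_upwards [hdiff] with x hx z hz
    exact hx.differentiableAt (hU.mem_nhds (hball hz).2)
  have hderiv_bound : ∀ᵐ x ∂μ, ∀ z ∈ Metric.ball z₀ (ε / 2),
      ‖deriv (fun z => F z x) z‖ ≤ b x / (ε / 4) := by
    filter_upwards [hdiffAt, hFb] with x hx hxb z hz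
    have hsub : Metric.closedBall z (ε / 4) ⊆ Metric.ball z₀ ε := fun y hy => by
      have h1 := Metric.mem_ball.1 hz
      have h2 := Metric.mem_closedBall.1 hy
      have := dist_triangle y z z₀
      exact Metric.mem_ball.2 (by linarith)
    refine Complex.norm_deriv_le_of_forall_mem_sphere_norm_le (R := ε / 4) (by positivity) ?_ ?_
    · refine DifferentiableOn.diffContOnCl fun y hy => ?_
      exact (hx y (hsub (Metric.closure_ball_subset_closedBall hy))).differentiableWithinAt
    · exact fun y hy => hxb y (hball (hsub (Metric.sphere_subset_closedBall hy))).1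
  have hFint : Integrable (F z₀) μ := by
    refine hb.mono' (hmeas z₀ hz₀) ?_
    filter_upwards [hFb] with x hx using hx z₀ (mem_of_mem_nhds hV)
  have hderiv_meas : AEStronglyMeasurable (fun x => deriv (fun z => F z x) z₀) μ := by
    set u : ℕ → ℂ := fun k => ((ε / 2 / ((k : ℝ) + 1) : ℝ) : ℂ)
    have hu : ∀ k : ℕ, 0 < ε / 2 / ((k : ℝ) + 1) := fun k => by positivity
    have hu0 : Tendsto u atTop (𝓝 0) := by
      have := (tendsto_one_div_add_atTop_nhds_zero_nat (𝕜 := ℝ)).const_mul (ε / 2)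
      have h2 := (Complex.continuous_ofReal.tendsto _).comp this
      simpa [u, Function.comp_def, div_eq_mul_inv] using h2
    have hmem : ∀ k, z₀ + u k ∈ U := fun k => by
      refine (hball (Metric.mem_ball.2 ?_)).2
      have : ε / 2 / ((k : ℝ) + 1) ≤ ε / 2 := div_le_self (by positivity) (by simp)
      simp only [u, dist_self_add_left, Complex.norm_real, Real.norm_of_nonneg (hu k).le]
      linarith
    refine aestronglyMeasurable_of_tendsto_ae atTop
      (f := fun k x => (u k)⁻¹ • (F (z₀ + u k) x - F z₀ x))
      (fun k => ((hmeas _ (hmem k)).sub (hmeas _ hz₀)).const_smul (u k)⁻¹) ?_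
    filter_upwards [hdiffAt] with x hx
    refine (hx z₀ (Metric.mem_ball_self hε)).hasDerivAt.tendsto_slope_zero.comp
      (tendsto_nhdsWithin_iff.2 ⟨hu0, .of_forall fun k => ?_⟩)
    exact Complex.ofReal_ne_zero.2 (hu k).ne'
  refine DifferentiableAt.differentiableWithinAt (HasDerivAt.differentiableAt
    (hasDerivAt_integral_of_dominated_loc_of_deriv_le
      (F' := fun z x => deriv (fun z => F z x) z) (Metric.ball_mem_nhds z₀ (half_pos hε)) ?_ hFint
      hderiv_meas hderiv_bound (hb.div_const _) ?_).2)
  · filter_upwards [hU.mem_nhds hz₀] with z hz using hmeas z hz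
  · filter_upwards [hdiffAt] with x hx z hz
    exact (hx z (Metric.ball_subset_ball (by linarith) hz)).hasDerivAt

/-- A double-exponentially decaying function is integrable against any exponential. -/
theorem integrableOn_exp_neg_exp_add_mul (x m p : ℝ) :
    IntegrableOn (fun u : ℝ => Real.exp (-Real.exp (x + u) + m * u)) (Ioi p) := by
  refine integrable_of_isBigO_exp_neg one_pos (by fun_prop) ?_
  have h := (Real.tendsto_exp_div_pow_atTop 1).const_mul_atTop (Real.exp_pos x)
  refine Asymptotics.IsBigO.of_bound 1 ?_
  filter_upwards [h.eventually_ge_atTop (m + 1), eventually_gt_atTop 0] with u hu hu0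
  have : (m + 1) * u ≤ Real.exp (x + u) := by
    rw [pow_one, ← mul_div_assoc, le_div_iff₀ hu0] at hu
    rwa [Real.exp_add]
  rw [Real.norm_of_nonneg (Real.exp_pos _).le, Real.norm_of_nonneg (Real.exp_pos _).le, one_mul,
    Real.exp_le_exp]
  linarith

/-- The function `t ↦ (t / (t - 1)) ^ a * t ^ p` in the variable `u = log t`, including the
Jacobian `exp u`, continued to the right half-plane. -/
noncomputable def logWeight (a p : ℝ) (u : ℂ) : ℂ :=
  Complex.exp ((1 + p) * u) * (1 - Complex.exp (-u)) ^ ((-a : ℝ) : ℂ)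

theorem one_sub_exp_neg_mem_slitPlane {u : ℂ} (hu : 0 < u.re) :
    1 - Complex.exp (-u) ∈ Complex.slitPlane := by
  refine Or.inl ?_
  have h1 : (Complex.exp (-u)).re ≤ ‖Complex.exp (-u)‖ := Complex.re_le_norm _
  have h2 : ‖Complex.exp (-u)‖ < 1 := by
    rw [Complex.norm_exp, Real.exp_lt_one_iff]; simpa using hu
  simp only [Complex.sub_re, Complex.one_re]
  linarith

theorem differentiableAt_logWeight (a p : ℝ) {u : ℂ} (hu : 0 < u.re) :
    DifferentiableAt ℂ (logWeight a p) u := by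
  unfold logWeight
  exact DifferentiableAt.mul (by fun_prop)
    (DifferentiableAt.cpow_const (by fun_prop) (one_sub_exp_neg_mem_slitPlane hu))

theorem norm_logWeight_le {a p : ℝ} (ha : 0 < a) {u : ℂ} (hu : Real.log 2 ≤ u.re) :
    ‖logWeight a p u‖ ≤ 2 ^ a * Real.exp (|1 + p| * u.re) := by
  have hu0 : 0 < u.re := (Real.log_pos one_lt_two).trans_le hu
  have h1 : (1 / 2 : ℝ) ≤ ‖1 - Complex.exp (-u)‖ := by
    have := norm_sub_norm_le (1 : ℂ) (Complex.exp (-u))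
    have h2 : ‖Complex.exp (-u)‖ ≤ 1 / 2 := by
      rw [Complex.norm_exp, Complex.neg_re, Real.exp_neg, one_div]
      exact inv_anti₀ two_pos ((Real.log_le_iff_le_exp two_pos).1 hu)
    rw [norm_one] at this
    linarith
  have h2 : ‖1 - Complex.exp (-u)‖ ^ (-a) ≤ 2 ^ a := by
    refine (Real.rpow_le_rpow_of_nonpos (by norm_num) h1 (by linarith)).trans_eq ?_
    rw [one_div, Real.inv_rpow two_pos.le, Real.rpow_neg two_pos.le, inv_inv]
  rw [logWeight, norm_mul, Complex.norm_cpow_real, Complex.norm_exp, mul_comm]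
  refine mul_le_mul h2 ?_ (by positivity) (by positivity)
  rw [Real.exp_le_exp]
  have : ((1 + (p : ℂ)) * u).re = (1 + p) * u.re := by simp
  rw [this]
  exact mul_le_mul_of_nonneg_right (le_abs_self _) hu0.le

theorem logWeight_ofReal (a p : ℝ) {u : ℝ} (hu : 0 < u) :
    logWeight a p u =
      (Real.exp u * ((Real.exp u / (Real.exp u - 1)) ^ a * Real.exp u ^ p) : ℝ) := by
  have h1 : Real.exp (-u) < 1 := by simpa using hu
  have h2 : Real.exp u / (Real.exp u - 1) = (1 - Real.exp (-u))⁻¹ := by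
    have : 1 - Real.exp (-u) ≠ 0 := by linarith
    have h3 : Real.exp u - 1 ≠ 0 := by
      have := Real.one_lt_exp_iff.2 hu
      linarith
    rw [Real.exp_neg] at *
    field_simp
  rw [h2, Real.inv_rpow (by linarith), ← Real.rpow_neg (by linarith), ← Real.exp_mul, logWeight,
    mul_left_comm, ← Real.exp_add, mul_comm]
  rw [Complex.ofReal_mul, Complex.ofReal_cpow (by linarith)]
  push_cast
  ring_nf

/-- The integrand `exp (-z * t) * (t / (t - 1)) ^ a * t ^ p`, with Jacobian, in the logarithmic
variables `L = log z` and `u = log t`. -/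
noncomputable def logKernel (a p : ℝ) (L u : ℂ) : ℂ :=
  Complex.exp (-Complex.exp (L + u)) * logWeight a p u

theorem DifferentiableAt.logKernel (a p : ℝ) {f g : ℂ → ℂ} {z : ℂ} (hf : DifferentiableAt ℂ f z)
    (hg : DifferentiableAt ℂ g z) (hz : 0 < (g z).re) :
    DifferentiableAt ℂ (fun z => logKernel a p (f z) (g z)) z := by
  unfold _root_.logKernel
  exact DifferentiableAt.mul (by fun_prop)
    ((differentiableAt_logWeight a p hz).comp (f := g) z hg)

theorem ContinuousOn.logKernel (a p : ℝ) (L : ℂ) {g : ℝ → ℂ} {s : Set ℝ} (hg : ContinuousOn g s)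
    (hpos : ∀ x ∈ s, 0 < (g x).re) : ContinuousOn (fun x => logKernel a p L (g x)) s := by
  intro x hx
  exact (DifferentiableAt.logKernel a p (f := fun _ => L) (g := fun u => u)
    (by fun_prop) (by fun_prop) (hpos x hx)).continuousAt.comp_continuousWithinAt (hg x hx)

/-- The integral of `logKernel a p L` over the contour which first joins `log 2` to `q - L` by a
segment and then follows the horizontal ray from `q - L` to the right. -/
noncomputable def contourIntegral (a p q : ℝ) (L : ℂ) : ℂ :=
  (q - L - Real.log 2) *
    (∫ x in Ioc (0 : ℝ) 1, logKernel a p L (Real.log 2 + (q - L - Real.log 2) * x)) +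
  ∫ y in Ioi q, logKernel a p L (y - L)

theorem differentiableOn_contourIntegral {a p q : ℝ} (ha : 0 < a) :
    DifferentiableOn ℂ (contourIntegral a p q) {L : ℂ | L.re < q - Real.log 2} := by
  have hU : IsOpen {L : ℂ | L.re < q - Real.log 2} :=
    isOpen_lt Complex.continuous_re continuous_const
  have hlog : 0 < Real.log 2 := Real.log_pos one_lt_two
  have hre (L : ℂ) (x : ℝ) : ((Real.log 2 : ℂ) + (q - L - Real.log 2) * x).re =
      Real.log 2 + (q - L.re - Real.log 2) * x := by
    generalize Real.log 2 = c
    simp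
  have hnear (z₀ : ℂ) (hz₀ : z₀ ∈ {L : ℂ | L.re < q - Real.log 2}) :
      {L : ℂ | L.re < q - Real.log 2} ∩ Metric.ball z₀ 1 ∈ 𝓝 z₀ :=
    inter_mem (hU.mem_nhds hz₀) (Metric.ball_mem_nhds _ one_pos)
  have hball {z z₀ : ℂ} (hz : z ∈ Metric.ball z₀ 1) : z₀.re - 1 < z.re ∧ z.re < z₀.re + 1 := by
    have h1 := Complex.abs_re_le_norm (z - z₀)
    have h2 : ‖z - z₀‖ < 1 := by simpa [dist_eq_norm] using hz
    have h3 := abs_lt.1 (h1.trans_lt h2)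
    rw [Complex.sub_re] at h3
    exact ⟨by linarith, by linarith⟩
  refine DifferentiableOn.add (DifferentiableOn.mul (by fun_prop) ?_) ?_
  · have hpos {L : ℂ} (hL : L.re < q - Real.log 2) {x : ℝ} (hx : x ∈ Ioc (0 : ℝ) 1) :
        Real.log 2 ≤ ((Real.log 2 : ℂ) + (q - L - Real.log 2) * x).re := by
      rw [hre]
      have := mul_nonneg (by linarith : 0 ≤ q - L.re - Real.log 2) hx.1.le
      linarith
    refine differentiableOn_integral_of_locally_dominated hU ?_ ?_ ?_
    · filter_upwards [ae_restrict_mem measurableSet_Ioc] with x hx L hL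
      exact (DifferentiableAt.logKernel a p (f := fun L => L)
        (g := fun L => Real.log 2 + (q - L - Real.log 2) * x) (by fun_prop) (by fun_prop)
        (hlog.trans_le (hpos hL hx))).differentiableWithinAt
    · intro L hL
      refine ContinuousOn.aestronglyMeasurable (ContinuousOn.logKernel a p L (by fun_prop)
        fun x hx => hlog.trans_le (hpos hL hx)) measurableSet_Ioc
    · intro z₀ hz₀
      refine ⟨_, hnear z₀ hz₀, fun _ => Real.exp (Real.exp (q + 1 - z₀.re + (z₀.re + 1))) *
        (2 ^ a * Real.exp (|1 + p| * (q + 1 - z₀.re))), integrable_const _, ?_⟩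
      filter_upwards [ae_restrict_mem measurableSet_Ioc] with x hx L hL
      obtain ⟨h1, h2⟩ := hball hL.2
      have hL1 : L.re < q - Real.log 2 := hL.1
      have hle : ((Real.log 2 : ℂ) + (q - L - Real.log 2) * x).re ≤ q + 1 - z₀.re := by
        rw [hre]
        have := mul_le_of_le_one_right (by linarith : 0 ≤ q - L.re - Real.log 2) hx.2
        linarith
      rw [logKernel, norm_mul]
      refine mul_le_mul ?_ ((norm_logWeight_le ha (hpos hL.1 hx)).trans ?_) (norm_nonneg _)
        (Real.exp_pos _).le
      · refine (Complex.norm_exp_le_exp_norm _).trans ?_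
        rw [norm_neg, Complex.norm_exp, Real.exp_le_exp, Real.exp_le_exp, Complex.add_re]
        linarith
      · gcongr
  · have hpos {L : ℂ} (hL : L.re < q - Real.log 2) {y : ℝ} (hy : y ∈ Ioi q) :
        Real.log 2 ≤ ((y : ℂ) - L).re := by
      have : q < y := hy
      rw [Complex.sub_re, Complex.ofReal_re]
      linarith
    refine differentiableOn_integral_of_locally_dominated hU ?_ ?_ ?_
    · filter_upwards [ae_restrict_mem measurableSet_Ioi] with y hy L hL
      exact (DifferentiableAt.logKernel a p (f := fun L => L) (g := fun L => y - L)
        (by fun_prop) (by fun_prop) (hlog.trans_le (hpos hL hy))).differentiableWithinAt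
    · intro L hL
      refine ContinuousOn.aestronglyMeasurable (ContinuousOn.logKernel a p L (by fun_prop)
        fun y hy => hlog.trans_le (hpos hL hy)) measurableSet_Ioi
    · intro z₀ hz₀
      refine ⟨_, hnear z₀ hz₀, fun y => 2 ^ a * Real.exp (|1 + p| * (1 - z₀.re)) *
        Real.exp (-Real.exp (0 + y) + |1 + p| * y),
        (integrableOn_exp_neg_exp_add_mul 0 |1 + p| q).const_mul _, ?_⟩
      filter_upwards [ae_restrict_mem measurableSet_Ioi] with y hy L hL
      obtain ⟨h1, h2⟩ := hball hL.2
      rw [logKernel, norm_mul, add_sub_cancel, zero_add, ← Complex.ofReal_exp, Complex.norm_exp,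
        Complex.neg_re, Complex.ofReal_re, mul_assoc, ← Real.exp_add]
      refine (mul_le_mul_of_nonneg_left (norm_logWeight_le ha (hpos hL.1 hy))
        (Real.exp_pos _).le).trans ?_
      rw [mul_left_comm, ← Real.exp_add]
      refine mul_le_mul_of_nonneg_left (Real.exp_le_exp.2 ?_) (by positivity)
      rw [Complex.sub_re, Complex.ofReal_re]
      have := mul_le_mul_of_nonneg_left h1.le (abs_nonneg (1 + p))
      linarith

theorem integrableOn_logKernel_ofReal {a : ℝ} (p x : ℝ) (ha : 0 < a) :
    IntegrableOn (fun u : ℝ => logKernel a p x u) (Ioi (Real.log 2)) := by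
  have hlog : 0 < Real.log 2 := Real.log_pos one_lt_two
  refine Integrable.mono' ((integrableOn_exp_neg_exp_add_mul x |1 + p| _).const_mul (2 ^ a))
    (ContinuousOn.aestronglyMeasurable (ContinuousOn.logKernel a p x (by fun_prop)
      fun y hy => ?_) measurableSet_Ioi) ?_
  · exact hlog.trans hy
  · filter_upwards [ae_restrict_mem measurableSet_Ioi] with y hy
    rw [logKernel, norm_mul, ← Complex.ofReal_add, ← Complex.ofReal_exp, Complex.norm_exp,
      Complex.neg_re, Complex.ofReal_re, Real.exp_add (-Real.exp (x + y)), mul_left_comm]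
    exact mul_le_mul_of_nonneg_left (norm_logWeight_le ha (le_of_lt hy)) (Real.exp_pos _).le

theorem contourIntegral_ofReal {a p q x : ℝ} (ha : 0 < a) (hx : x < q - Real.log 2) :
    contourIntegral a p q x = ∫ u in Ioi (Real.log 2), logKernel a p x (u : ℝ) := by
  have h1 := intervalIntegral.smul_integral_comp_add_mul (a := 0) (b := 1)
    (fun u : ℝ => logKernel a p x u) (q - x - Real.log 2) (Real.log 2)
  have h2 : ∫ y in Ioi q, logKernel a p x (y - x) =
      ∫ u in Ioi (q - x), logKernel a p x (u : ℝ) := by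
    have := (measurePreserving_sub_right volume x).setIntegral_preimage_emb
      (measurableEmbedding_subRight x) (fun u : ℝ => logKernel a p x u) (Ioi (q - x))
    simpa using this
  have hint := integrableOn_logKernel_ofReal p x ha
  rw [contourIntegral, h2, ← intervalIntegral.integral_interval_add_Ioi hint
    (hint.mono_set (Ioi_subset_Ioi (by linarith : Real.log 2 ≤ q - x))),
    ← intervalIntegral.integral_of_le zero_le_one]
  congr 1
  rw [mul_zero, mul_one, add_zero, add_sub_cancel] at h1
  rw [← h1, Complex.real_smul]
  push_cast
  rfl

theorem contourIntegral_eq_of_re_lt {a p q q' : ℝ} (ha : 0 < a) {L : ℂ}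
    (hq : L.re < q - Real.log 2) (hq' : L.re < q' - Real.log 2) :
    contourIntegral a p q L = contourIntegral a p q' L := by
  wlog h : q ≤ q' generalizing q q'
  · exact (this hq' hq (le_of_not_ge h)).symm
  have hU : IsOpen {L : ℂ | L.re < q - Real.log 2} :=
    isOpen_lt Complex.continuous_re continuous_const
  have hd := differentiableOn_contourIntegral (p := p) (q := q) ha
  have hd' : DifferentiableOn ℂ (contourIntegral a p q') {L : ℂ | L.re < q - Real.log 2} :=
    (differentiableOn_contourIntegral ha).mono fun z (hz : z.re < _) => by
      show z.re < _
      linarith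
  refine (hd.analyticOnNhd hU).eqOn_of_preconnected_of_frequently_eq (hd'.analyticOnNhd hU)
    (convex_halfSpace_re_lt _).isPreconnected (z₀ := (L.re : ℂ)) (by simpa using hq) ?_ hq
  have hu : Tendsto (fun y : ℝ => (y : ℂ)) (𝓝[<] L.re) (𝓝[≠] (L.re : ℂ)) := by
    refine tendsto_nhdsWithin_iff.2
      ⟨(Complex.continuous_ofReal.tendsto _).mono_left nhdsWithin_le_nhds, ?_⟩
    filter_upwards [self_mem_nhdsWithin] with y hy
    exact Complex.ofReal_injective.ne (ne_of_lt hy)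
  refine hu.frequently (Eventually.frequently ?_)
  filter_upwards [self_mem_nhdsWithin] with y (hy : y < L.re)
  rw [contourIntegral_ofReal ha (by linarith), contourIntegral_ofReal ha (by linarith)]

theorem differentiable_contourIntegral_re_add_one {a p : ℝ} (ha : 0 < a) :
    Differentiable ℂ fun L => contourIntegral a p (L.re + 1) L := by
  intro L₀
  have hlog : Real.log 2 < 1 := (Real.log_two_lt_d9).trans (by norm_num)
  have hnhds : {L : ℂ | L.re < L₀.re + 2 - Real.log 2} ∈ 𝓝 L₀ :=
    (isOpen_lt Complex.continuous_re continuous_const).mem_nhds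
      (show L₀.re < L₀.re + 2 - Real.log 2 by linarith)
  have hd := (differentiableOn_contourIntegral (p := p) ha).differentiableAt hnhds
  refine hd.congr_of_eventuallyEq ?_
  filter_upwards [hnhds] with L hL
  exact contourIntegral_eq_of_re_lt ha (by linarith) hL

theorem exp_smul_integrand_exp (a p x : ℝ) {u : ℝ} (hu : 0 < u) :
    Real.exp u • ((Real.exp (-Real.exp x * Real.exp u) *
      (Real.exp u / (Real.exp u - 1)) ^ a * Real.exp u ^ p : ℝ) : ℂ) = logKernel a p x u := by
  rw [logKernel, logWeight_ofReal a p hu, ← Complex.ofReal_add, ← Complex.ofReal_exp,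
    ← Complex.ofReal_neg, ← Complex.ofReal_exp, ← Complex.ofReal_mul, Complex.real_smul,
    ← Complex.ofReal_mul, Real.exp_add x, neg_mul]
  congr 1
  ring

theorem integrableOn_Ioi_two_integrand {a : ℝ} (p x : ℝ) (ha : 0 < a) :
    IntegrableOn (fun t : ℝ => Real.exp (-Real.exp x * t) * (t / (t - 1)) ^ a * t ^ p)
      (Ioi 2) := by
  have h := (integrableOn_comp_exp_Ioi (fun t : ℝ => ((Real.exp (-Real.exp x * t) *
    (t / (t - 1)) ^ a * t ^ p : ℝ) : ℂ)) (Real.log 2)).1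
      ((integrableOn_logKernel_ofReal p x ha).congr_fun (fun u hu =>
        (exp_smul_integrand_exp a p x ((Real.log_pos one_lt_two).trans hu)).symm)
        measurableSet_Ioi)
  rw [Real.exp_log two_pos] at h
  exact h.re

theorem integral_Ioi_log_two_logKernel (a p x : ℝ) :
    ∫ u in Ioi (Real.log 2), logKernel a p x (u : ℝ) =
      ((∫ t in Ioi 2, Real.exp (-Real.exp x * t) * (t / (t - 1)) ^ a * t ^ p : ℝ) : ℂ) := by
  have h := integral_comp_exp_Ioi (fun t : ℝ => ((Real.exp (-Real.exp x * t) *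
    (t / (t - 1)) ^ a * t ^ p : ℝ) : ℂ)) (Real.log 2)
  rw [Real.exp_log two_pos] at h
  rw [← integral_complex_ofReal, ← h]
  exact setIntegral_congr_fun measurableSet_Ioi fun u hu =>
    (exp_smul_integrand_exp a p x ((Real.log_pos one_lt_two).trans hu)).symm

theorem integrableOn_Ioc_one_two_weight {a : ℝ} (p : ℝ) (ha : a < 1) :
    IntegrableOn (fun t : ℝ => (t / (t - 1)) ^ a * t ^ p) (Ioc 1 2) := by
  have h1 : IntervalIntegrable (fun t : ℝ => (t - 1) ^ (-a)) volume 1 2 := by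
    have := (intervalIntegral.intervalIntegrable_rpow' (a := 0) (b := 1)
      (by linarith : -1 < -a)).comp_sub_right 1
    simpa [one_add_one_eq_two] using this
  have hpos : ∀ t ∈ uIcc (1 : ℝ) 2, t ≠ 0 := fun t ht => by
    rw [uIcc_of_le one_le_two] at ht
    linarith [ht.1]
  have h2 := h1.continuousOn_mul (g := fun t : ℝ => t ^ a * t ^ p)
    (ContinuousOn.mul (continuousOn_id.rpow_const fun t ht => Or.inl (hpos t ht))
      (continuousOn_id.rpow_const fun t ht => Or.inl (hpos t ht)))
  refine ((intervalIntegrable_iff_integrableOn_Ioc_of_le one_le_two).1 h2).congr_fun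
    (fun t ht => ?_) measurableSet_Ioc
  have h3 : 0 < t - 1 := by linarith [ht.1]
  simp only [Real.div_rpow (by linarith [h3] : 0 ≤ t) h3.le, Real.rpow_neg h3.le]
  ring

theorem differentiable_integral_exp_neg_mul_of_integrableOn_Ioc {f : ℝ → ℝ} {c d : ℝ}
    (hf : IntegrableOn f (Ioc c d)) :
    Differentiable ℂ fun z : ℂ => ∫ t in Ioc c d, Complex.exp (-z * t) * f t := by
  rw [← differentiableOn_univ]
  have hmeas (z : ℂ) : AEStronglyMeasurable (fun t : ℝ => Complex.exp (-z * t) * (f t : ℂ))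
      (volume.restrict (Ioc c d)) :=
    (Continuous.aestronglyMeasurable (by fun_prop)).mul hf.ofReal.aestronglyMeasurable
  refine differentiableOn_integral_of_locally_dominated isOpen_univ
    (.of_forall fun t => by fun_prop) (fun z _ => hmeas z) fun z₀ _ =>
    ⟨_, Metric.ball_mem_nhds z₀ one_pos,
      fun t => Real.exp ((‖z₀‖ + 1) * max |c| |d|) * |f t|, hf.abs.const_mul _, ?_⟩
  filter_upwards [ae_restrict_mem measurableSet_Ioc] with t ht z hz
  have hz' : ‖z‖ ≤ ‖z₀‖ + 1 := by
    have h1 : ‖z - z₀‖ < 1 := by simpa [dist_eq_norm] using hz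
    have h2 := norm_sub_norm_le z z₀
    linarith
  have ht' : |t| ≤ max |c| |d| := abs_le_max_abs_abs ht.1.le ht.2
  rw [norm_mul, Complex.norm_real, Real.norm_eq_abs]
  refine mul_le_mul_of_nonneg_right ((Complex.norm_exp_le_exp_norm _).trans ?_) (abs_nonneg _)
  rw [norm_mul, norm_neg, Complex.norm_real, Real.norm_eq_abs]
  gcongr

theorem integrableOn_Ioi_one_integrand {a : ℝ} (p x : ℝ) (ha : a ∈ Ioo (0 : ℝ) 1) :
    IntegrableOn (fun t : ℝ => Real.exp (-Real.exp x * t) * (t / (t - 1)) ^ a * t ^ p)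
      (Ioi 1) := by
  rw [← Ioc_union_Ioi_eq_Ioi (one_le_two : (1 : ℝ) ≤ 2)]
  refine IntegrableOn.union ?_ (integrableOn_Ioi_two_integrand p x ha.1)
  have h := ((intervalIntegrable_iff_integrableOn_Ioc_of_le one_le_two).2
    (integrableOn_Ioc_one_two_weight p ha.2)).continuousOn_mul
    (g := fun t : ℝ => Real.exp (-Real.exp x * t)) (by fun_prop)
  simpa only [mul_assoc] using (intervalIntegrable_iff_integrableOn_Ioc_of_le one_le_two).1 h

/-- The logarithm of `w ^ 3` on the plane slit along the negative imaginary axis that is real for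
`w > 0`. -/
noncomputable def logCube (w : ℂ) : ℂ :=
  3 * (Complex.log (-Complex.I * w) + Real.pi / 2 * Complex.I)

theorem differentiableAt_logCube {w : ℂ} (him : 0 ≤ w.im) (hw : w ≠ 0) :
    DifferentiableAt ℂ logCube w := by
  have h : -Complex.I * w ∈ Complex.slitPlane := by
    rw [Complex.mem_slitPlane_iff]
    simp only [neg_mul, Complex.neg_re, Complex.neg_im, Complex.I_mul_re, Complex.I_mul_im,
      neg_neg]
    by_contra! hcon
    exact hw (Complex.ext (by simpa using hcon.2) (le_antisymm hcon.1 him))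
  unfold logCube
  exact (((by fun_prop : DifferentiableAt ℂ (fun w : ℂ => -Complex.I * w) w).clog h).add_const
    _).const_mul _

theorem logCube_ofReal {w : ℝ} (hw : 0 < w) : logCube w = (Real.log (w ^ 3) : ℝ) := by
  rw [logCube, mul_comm (-Complex.I), Complex.log_ofReal_mul hw (by simp), Complex.log_neg_I,
    Real.log_pow]
  push_cast
  ring

/-- For `a ∈ (0,1)` and `n > 0`, the integral
`Q_n(w;a) = ∫₁^∞ e^{-w³t}(t/(t-1))^a·t^{-2n/3} dt` converges absolutely for
every `w > 0`, and there is a function `F : ℂ → ℂ`, analytic on the open upper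
half-plane, continuous on `{Im w ≥ 0, w ≠ 0}`, with `F(w) = Q_n(w;a)` for real
`w > 0`. -/
theorem Q_analytic_continuation
    (a n : ℝ) (ha : a ∈ Set.Ioo (0 : ℝ) 1) (hn : 0 < n) :
    (∀ w : ℝ, 0 < w → IntegrableOn
      (fun t : ℝ => Real.exp (-(w ^ 3) * t) * (t / (t - 1)) ^ a * t ^ (-(2 * n) / 3))
      (Set.Ioi (1 : ℝ))) ∧
    ∃ F : ℂ → ℂ,
      DifferentiableOn ℂ F {w : ℂ | 0 < w.im} ∧
      ContinuousOn F {w : ℂ | 0 ≤ w.im ∧ w ≠ 0} ∧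
      ∀ w : ℝ, 0 < w →
        F (w : ℂ) = ((∫ t in Set.Ioi (1 : ℝ),
          Real.exp (-(w ^ 3) * t) * (t / (t - 1)) ^ a * t ^ (-(2 * n) / 3) : ℝ) : ℂ) := by
  set p : ℝ := -(2 * n) / 3
  have hint (w : ℝ) (hw : 0 < w) : IntegrableOn
      (fun t : ℝ => Real.exp (-(w ^ 3) * t) * (t / (t - 1)) ^ a * t ^ p) (Ioi 1) := by
    have h := integrableOn_Ioi_one_integrand p (Real.log (w ^ 3)) ha
    rwa [Real.exp_log (pow_pos hw 3)] at h
  set near : ℂ → ℂ := fun z =>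
    ∫ t in Ioc (1 : ℝ) 2, Complex.exp (-z * t) * ((t / (t - 1)) ^ a * t ^ p : ℝ)
  set far : ℂ → ℂ := fun L => contourIntegral a p (L.re + 1) L
  have hnear : Differentiable ℂ near := differentiable_integral_exp_neg_mul_of_integrableOn_Ioc
    (integrableOn_Ioc_one_two_weight p ha.2)
  have hfar : Differentiable ℂ far := differentiable_contourIntegral_re_add_one ha.1
  have hdiff (w : ℂ) (him : 0 ≤ w.im) (hw : w ≠ 0) :
      DifferentiableAt ℂ (fun w => near (w ^ 3) + far (logCube w)) w :=
    ((hnear _).comp w (by fun_prop : DifferentiableAt ℂ (fun w : ℂ => w ^ 3) w)).add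
      ((hfar _).comp w (differentiableAt_logCube him hw))
  refine ⟨hint, fun w => near (w ^ 3) + far (logCube w), fun w hw => ?_, fun w hw => ?_,
    fun w hw => ?_⟩
  · have him : 0 < w.im := hw
    refine (hdiff w him.le ?_).differentiableWithinAt
    rintro rfl
    simp at him
  · exact (hdiff w hw.1 hw.2).continuousAt.continuousWithinAt
  · have hlog : Real.log 2 < 1 := Real.log_two_lt_d9.trans (by norm_num)
    have hfar_eq : far (logCube w) = ((∫ t in Ioi 2,
        Real.exp (-(w ^ 3) * t) * (t / (t - 1)) ^ a * t ^ p : ℝ) : ℂ) := by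
      simp only [far, logCube_ofReal hw, Complex.ofReal_re]
      rw [contourIntegral_ofReal ha.1 (by linarith), integral_Ioi_log_two_logKernel,
        Real.exp_log (pow_pos hw 3)]
    have hnear_eq : near ((w : ℂ) ^ 3) = ((∫ t in Ioc 1 2,
        Real.exp (-(w ^ 3) * t) * (t / (t - 1)) ^ a * t ^ p : ℝ) : ℂ) := by
      rw [← integral_complex_ofReal]
      refine setIntegral_congr_fun measurableSet_Ioc fun t _ => ?_
      simp only [mul_assoc]
      push_cast
      rfl
    have hunion := Ioc_union_Ioi_eq_Ioi (one_le_two : (1 : ℝ) ≤ 2)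
    simp only [hfar_eq, hnear_eq, ← Complex.ofReal_add]
    rw [← hunion, setIntegral_union (Ioc_disjoint_Ioi le_rfl) measurableSet_Ioi
      ((hint w hw).mono_set Ioc_subset_Ioi_self)
      ((hint w hw).mono_set (Ioi_subset_Ioi one_le_two))]
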